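/- The group G geometrically contains N × N in N: for all g, h ∈ N there exists k ∈ N such that k(0·w) = 0·g(w) and k(1·w) = 1·h(w) for all finite binary words w (so k stabilizes the first level and has first-level sections g and h). -/

import Mathlib

/-- The tree automorphism `a` as a function: flips the first letter. -/
def aFun : List Bool → List Bool
  | [] => []
  | x :: w => (!x) :: w

mutual
  /-- The tree automorphism `b` as a function. -/
  def bFun : List Bool → List Bool
    | [] => []
    | false :: w => false :: aFun w
    | true :: w => true :: cFun w
  /-- The tree automorphism `c` as a function. -/
  def cFun : List Bool → List Bool
    | [] => []
    | false :: w => false :: bFun w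
    | true :: w => true :: w
end

theorem aFun_involutive : Function.Involutive aFun := by
  intro w
  cases w with
  | nil => rfl
  | cons x t => cases x <;> rfl

theorem bcFun_involutive : ∀ w, bFun (bFun w) = w ∧ cFun (cFun w) = w := by
  intro w
  induction w with
  | nil => exact ⟨rfl, rfl⟩
  | cons x t ih =>
    cases x
    · exact ⟨by simp [bFun, aFun_involutive t], by simp [cFun, ih.1]⟩
    · exact ⟨by simp [bFun, ih.2], by simp [cFun]⟩

/-- The tree automorphism `a` of the binary rooted tree `{0,1}*`. -/
def treeA : Equiv.Perm (List Bool) := Function.Involutive.toPerm aFun aFun_involutive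

/-- The tree automorphism `b` of the binary rooted tree `{0,1}*`. -/
def treeB : Equiv.Perm (List Bool) :=
  Function.Involutive.toPerm bFun (fun w => (bcFun_involutive w).1)

/-- The tree automorphism `c` of the binary rooted tree `{0,1}*`. -/
def treeC : Equiv.Perm (List Bool) :=
  Function.Involutive.toPerm cFun (fun w => (bcFun_involutive w).2)

/-- The group `G = IMG(z²+i)`, the subgroup of `Perm({0,1}*)` generated by `a`, `b`, `c`. -/
def IMG : Subgroup (Equiv.Perm (List Bool)) := Subgroup.closure {treeA, treeB, treeC}

theorem treeA_mem_IMG : treeA ∈ IMG := Subgroup.subset_closure (by simp)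
theorem treeB_mem_IMG : treeB ∈ IMG := Subgroup.subset_closure (by simp)
theorem treeC_mem_IMG : treeC ∈ IMG := Subgroup.subset_closure (by simp)

/-- `a` as an element of the group `G`. -/
def gA : IMG := ⟨treeA, treeA_mem_IMG⟩
/-- `b` as an element of the group `G`. -/
def gB : IMG := ⟨treeB, treeB_mem_IMG⟩
/-- `c` as an element of the group `G`. -/
def gC : IMG := ⟨treeC, treeC_mem_IMG⟩

/-- The commutator `[x, y] = x⁻¹y⁻¹xy`. -/
def commElt {M : Type*} [Group M] (x y : M) : M := x⁻¹ * y⁻¹ * x * y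

/-- The normal closure `N` in `G` of the commutators `[a,b]` and `[b,c]`. -/
def NN : Subgroup IMG := Subgroup.normalClosure {commElt gA gB, commElt gB gC}

/-- The permutation `k` stabilizes the first level, with first-level sections `g` and `h`. -/
def HasSections (k g h : Equiv.Perm (List Bool)) : Prop :=
  (∀ w, k (false :: w) = false :: g w) ∧ ∀ w, k (true :: w) = true :: h w

namespace HasSections

variable {k g h k' g' h' : Equiv.Perm (List Bool)}

theorem one : HasSections 1 1 1 := ⟨fun _ => rfl, fun _ => rfl⟩

theorem mul (H : HasSections k g h) (H' : HasSections k' g' h') :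
    HasSections (k * k') (g * g') (h * h') :=
  ⟨fun w => by simp [H'.1, H.1], fun w => by simp [H'.2, H.2]⟩

theorem inv (H : HasSections k g h) : HasSections k⁻¹ g⁻¹ h⁻¹ :=
  ⟨fun w => by rw [Equiv.Perm.inv_eq_iff_eq, H.1]; simp,
    fun w => by rw [Equiv.Perm.inv_eq_iff_eq, H.2]; simp⟩

protected theorem commElt (H : HasSections k g h) (H' : HasSections k' g' h') :
    HasSections (commElt k k') (commElt g g') (commElt h h') :=
  ((H.inv.mul H'.inv).mul H).mul H'

theorem conj_treeA (H : HasSections k g h) : HasSections (treeA * k * treeA⁻¹) h g :=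
  ⟨fun w => (congrArg aFun (H.2 w) :), fun w => (congrArg aFun (H.1 w) :)⟩

end HasSections

theorem hasSections_treeB : HasSections treeB treeA treeC :=
  ⟨fun w => bFun.eq_2 w, fun w => bFun.eq_3 w⟩

theorem hasSections_treeC : HasSections treeC treeB 1 :=
  ⟨fun w => cFun.eq_2 w, fun w => cFun.eq_3 w⟩

/-- Every element of `G` is the first section of an element of `G` stabilizing the first level. -/
theorem exists_hasSections_of_mem_IMG {g : Equiv.Perm (List Bool)} (hg : g ∈ IMG) :
    ∃ k ∈ IMG, ∃ h, HasSections k g h := by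
  induction hg using Subgroup.closure_induction with
  | mem x hx =>
    rcases hx with rfl | rfl | rfl
    · exact ⟨_, treeB_mem_IMG, _, hasSections_treeB⟩
    · exact ⟨_, treeC_mem_IMG, _, hasSections_treeC⟩
    · exact ⟨_, mul_mem (mul_mem treeA_mem_IMG treeB_mem_IMG) (inv_mem treeA_mem_IMG), _,
        hasSections_treeB.conj_treeA⟩
  | one => exact ⟨1, one_mem _, 1, .one⟩
  | mul x y _ _ hx hy =>
    obtain ⟨k, hk, h, H⟩ := hx
    obtain ⟨k', hk', h', H'⟩ := hy
    exact ⟨_, mul_mem hk hk', _, H.mul H'⟩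
  | inv x _ hx =>
    obtain ⟨k, hk, h, H⟩ := hx
    exact ⟨_, inv_mem hk, _, H.inv⟩

instance NN_normal : NN.Normal := Subgroup.normalClosure_normal

theorem commElt_gA_gB_mem_NN : commElt gA gB ∈ NN := Subgroup.subset_normalClosure (by simp)

theorem commElt_gB_gC_mem_NN : commElt gB gC ∈ NN := Subgroup.subset_normalClosure (by simp)

theorem commElt_eq_one_iff {M : Type*} [Group M] {x y : M} : commElt x y = 1 ↔ Commute x y := by
  rw [commElt, mul_assoc, ← mul_inv_rev, inv_mul_eq_one, eq_comm]
  rfl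

/-- Modulo `N` the generator `b` is central, so it equals its conjugate by `a` and commutes
with `c`. -/
theorem commElt_gC_conj_gB_mem_NN : commElt gC (gA * gB * gA⁻¹) ∈ NN := by
  have hab := (QuotientGroup.eq_one_iff (N := NN) _).2 commElt_gA_gB_mem_NN
  have hbc := (QuotientGroup.eq_one_iff (N := NN) _).2 commElt_gB_gC_mem_NN
  rw [← QuotientGroup.eq_one_iff (N := NN)]
  replace hab : Commute (gA : IMG ⧸ NN) gB := commElt_eq_one_iff.1 hab
  replace hbc : Commute (gB : IMG ⧸ NN) gC := commElt_eq_one_iff.1 hbc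
  change commElt (gC : IMG ⧸ NN) (gA * gB * (gA : IMG ⧸ NN)⁻¹) = 1
  rw [hab.eq, mul_inv_cancel_right]
  exact commElt_eq_one_iff.2 hbc.symm

/-- The elements `g` of `G` for which `N` contains the permutation with first-level
sections `g` and `1`. -/
def firstSections : Subgroup IMG where
  carrier := {g | ∃ k ∈ NN, HasSections k g 1}
  one_mem' := ⟨1, one_mem _, .one⟩
  mul_mem' := by
    rintro x y ⟨k, hk, H⟩ ⟨k', hk', H'⟩
    exact ⟨_, mul_mem hk hk', by simpa using H.mul H'⟩
  inv_mem' := by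
    rintro x ⟨k, hk, H⟩
    exact ⟨_, inv_mem hk, by simpa using H.inv⟩

instance firstSections_normal : firstSections.Normal where
  conj_mem := by
    rintro x ⟨k, hk, H⟩ g
    obtain ⟨t, ht, s, T⟩ := exists_hasSections_of_mem_IMG g.2
    exact ⟨_, NN_normal.conj_mem k hk ⟨t, ht⟩, by simpa using (T.mul H).mul T.inv⟩

theorem NN_le_firstSections : NN ≤ firstSections := by
  apply Subgroup.normalClosure_le_normal
  rintro x (rfl | rfl)
  · exact ⟨_, commElt_gB_gC_mem_NN,
      by simpa [commElt, gA, gB, gC] using hasSections_treeB.commElt hasSections_treeC⟩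
  · exact ⟨_, commElt_gC_conj_gB_mem_NN,
      by simpa [commElt, gA, gB, gC] using hasSections_treeC.commElt hasSections_treeB.conj_treeA⟩

/-- `N × N` is geometrically contained in `N`. -/
theorem NN_times_NN_in_NN :
    ∀ g ∈ NN, ∀ h ∈ NN, ∃ k ∈ NN,
      (∀ w : List Bool, (k : Equiv.Perm (List Bool)) (false :: w)
          = false :: (g : Equiv.Perm (List Bool)) w) ∧
      (∀ w : List Bool, (k : Equiv.Perm (List Bool)) (true :: w)
          = true :: (h : Equiv.Perm (List Bool)) w) := by
  intro g hg h hh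
  obtain ⟨k, hk, H⟩ := NN_le_firstSections hg
  obtain ⟨k', hk', H'⟩ := NN_le_firstSections hh
  have K : HasSections (k * (treeA * k' * treeA⁻¹)) g h := by simpa using H.mul H'.conj_treeA
  exact ⟨k * (gA * k' * gA⁻¹), mul_mem hk (NN_normal.conj_mem k' hk' gA), K.1, K.2⟩
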